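/- arXiv:math/0611525 — 2 statements merged into one kernel-verified Lean document; each statement's English description precedes it below -/
import Mathlib

section
/- Let Λ be a finite set with at least two elements, let A be a generator (Q-matrix) on Λ, fix a, b ∈ Λ, and let v ∈ ℂ^Λ satisfy Re(v_x) < 0 for all x; let V be the diagonal matrix with entries V_{x,x} = v_x. Then: (1) for every S with {a,b} ⊆ S ⊆ Λ the matrix −(A+V)_{S×S} (the submatrix of −(A+V) indexed by S) is invertible; (2) the function l ↦ e^{⟨v,l⟩} ρ_{ab}^{(Λ)}(l) is integrable on (0,∞)^Λ; and (3) Σ_{S : {a,b} ⊆ S ⊆ Λ} (−1)^{|Λ|−|S|} ((−(A+V)_{S×S})^{-1})_{a,b} = ∫_{(0,∞)^Λ} e^{⟨v,l⟩} ρ_{ab}^{(Λ)}(l) d^Λl, where ⟨v,l⟩ = Σ_{x∈Λ} v_x l_x. -/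
open MeasureTheory Finset

noncomputable section

/-- The `(b,a)` cofactor of the `S × S` submatrix of `M`. -/
def cofDet {α : Type*} [Fintype α] [DecidableEq α]
    (S : Finset α) (M : Matrix α α ℂ) (a b : α) : ℂ :=
  (Matrix.of fun x y : S => if (x : α) = b then (if (y : α) = a then (1:ℂ) else 0)
    else (if (y : α) = a then 0 else M x y)).det

/-- Partial derivative in direction `x`. -/
def pd {α : Type*} [Fintype α] [DecidableEq α] (x : α) (f : (α → ℝ) → ℂ) :
    (α → ℝ) → ℂ :=
  fun l => fderiv ℝ f l (Pi.single x 1)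

/-- Mixed partial derivative `∂^Q f`. -/
def mpart {α : Type*} [Fintype α] [DecidableEq α] (Q : Finset α) (f : (α → ℝ) → ℂ) :
    (α → ℝ) → ℂ :=
  Q.toList.foldr pd f

/-- The differential operator `det_{ab}^{(α)}(M + ∂_l)` applied to `f` at `l`. -/
def ddet {α : Type*} [Fintype α] [DecidableEq α]
    (M : Matrix α α ℂ) (a b : α) (f : (α → ℝ) → ℂ) (l : α → ℝ) : ℂ :=
  ∑ Q ∈ ((Finset.univ : Finset α) \ {a, b}).powerset,
    cofDet ((Finset.univ : Finset α) \ Q) M a b * mpart Q f l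

/-- `G_M(l) = ∫_{[0,2π]^α} exp(Σ_{x,y} M_{x,y} √(l_x l_y) e^{i(θ_x−θ_y)}) ∏ dθ_x/(2π)`. -/
def GM {α : Type*} [Fintype α] [DecidableEq α] (M : Matrix α α ℝ) (l : α → ℝ) : ℂ :=
  ((2 * Real.pi : ℂ) ^ (Fintype.card α))⁻¹ *
    ∫ θ in Set.univ.pi (fun _ : α => Set.Icc (0:ℝ) (2 * Real.pi)),
      Complex.exp (∑ x, ∑ y, (M x y : ℂ) * (Real.sqrt (l x * l y) : ℂ) *
        Complex.exp (Complex.I * ((θ x : ℂ) - (θ y : ℂ))))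

/-- The local-time density `ρ_{ab}(l) = (det_{ab}(−A + ∂_l) G_A)(l)`. -/
def rho {α : Type*} [Fintype α] [DecidableEq α]
    (A : Matrix α α ℝ) (a b : α) (l : α → ℝ) : ℂ :=
  ddet ((-A).map (fun r => (r : ℂ))) a b (GM A) l

/-! ### Algebra of determinants -/

/-- Rows outside `S` replaced by rows of the identity. -/
def rowRep {α : Type*} [Fintype α] [DecidableEq α] (S : Finset α) (N : Matrix α α ℂ) :
    Matrix α α ℂ :=
  Matrix.of fun x y => if x ∈ S then N x y else if x = y then 1 else 0

lemma det_rowRep {α : Type*} [Fintype α] [DecidableEq α] (S : Finset α) (N : Matrix α α ℂ) :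
    (rowRep S N).det = (Matrix.of fun x y : S => N x y).det := by
  rw [Matrix.twoBlockTriangular_det (rowRep S N) (fun x => x ∈ S)]
  · have h2 : (Matrix.toSquareBlockProp (rowRep S N) fun i => ¬ i ∈ S) = 1 := by
      ext ⟨x, hx⟩ ⟨y, hy⟩
      simp [Matrix.toSquareBlockProp, rowRep, hx, Matrix.one_apply]
    have h1 : (Matrix.toSquareBlockProp (rowRep S N) fun i => i ∈ S)
        = Matrix.of fun x y : S => N x y := by
      ext ⟨x, hx⟩ ⟨y, hy⟩
      simp [Matrix.toSquareBlockProp, rowRep, hx]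
    rw [h2, Matrix.det_one, mul_one]
    convert congrArg Matrix.det h1
  · intro i hi j hj
    have : i ≠ j := by rintro rfl; exact hi hj
    simp [rowRep, hi, this]

lemma det_add_diag {α : Type*} [Fintype α] [DecidableEq α] (N : Matrix α α ℂ) (d : α → ℂ) :
    (N + Matrix.diagonal d).det =
      ∑ s : Finset α, (∏ x ∈ sᶜ, d x) * (rowRep s N).det := by
  have h := (Matrix.detRowAlternating (n := α) (R := ℂ)).map_add_univ N (Matrix.diagonal d)
  refine h.trans (Finset.sum_congr rfl fun s _ => ?_)
  have h2 : (s.piecewise N (Matrix.diagonal d) : α → α → ℂ)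
      = fun x => (if x ∈ s then 1 else d x) • (rowRep s N) x := by
    funext x y
    by_cases hx : x ∈ s
    · refine (congrFun (Finset.piecewise_eq_of_mem s (fun i => N i) (Matrix.diagonal d) hx) y).trans ?_
      simp [hx, rowRep]
    · refine (congrFun (Finset.piecewise_eq_of_notMem s (fun i => N i) (Matrix.diagonal d) hx) y).trans ?_
      by_cases hxy : x = y
      · subst hxy; simp [hx, rowRep]
      · simp [hx, rowRep, hxy]
  have h3 : (∏ x ∈ sᶜ, d x) = ∏ x, (if x ∈ s then 1 else d x) := by
    rw [← Finset.prod_compl_mul_prod s]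
    rw [Finset.prod_congr (s₁ := s) rfl (fun x hx => if_pos hx)]
    rw [Finset.prod_congr (s₁ := sᶜ) (f := fun x => if x ∈ s then 1 else d x) rfl
        (fun x hx => if_neg (Finset.mem_compl.1 hx))]
    simp
  rw [h3, h2]
  exact (Matrix.detRowAlternating (n := α) (R := ℂ)).map_smul_univ _ _

/-- The modified matrix of the cofactor. -/
def cofMat {α : Type*} [Fintype α] [DecidableEq α] (M : Matrix α α ℂ) (a b : α) :
    Matrix α α ℂ :=
  Matrix.of fun x y => if x = b then (if y = a then (1:ℂ) else 0)
    else (if y = a then 0 else M x y)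

lemma cofDet_eq {α : Type*} [Fintype α] [DecidableEq α] (S : Finset α) (M : Matrix α α ℂ)
    (a b : α) : cofDet S M a b = (rowRep S (cofMat M a b)).det := by
  rw [det_rowRep]; rfl

lemma cofDet_univ {α : Type*} [Fintype α] [DecidableEq α] (M : Matrix α α ℂ)
    (a b : α) : cofDet Finset.univ M a b = (cofMat M a b).det := by
  rw [cofDet_eq]; congr 1; ext x y; simp [rowRep]

lemma cofDet_add_diag {α : Type*} [Fintype α] [DecidableEq α] (M : Matrix α α ℂ)
    (d : α → ℂ) (a b : α) :
    cofDet Finset.univ (M + Matrix.diagonal d) a b =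
      ∑ Q ∈ ((Finset.univ : Finset α) \ {a, b}).powerset,
        cofDet ((Finset.univ : Finset α) \ Q) M a b * ∏ x ∈ Q, d x := by
  rw [cofDet_univ]
  have h : cofMat (M + Matrix.diagonal d) a b
      = cofMat M a b + Matrix.diagonal (fun x => if x = a ∨ x = b then 0 else d x) := by
    ext x y
    by_cases hxb : x = b
    · subst hxb
      simp [cofMat, Matrix.diagonal_apply]
    · by_cases hya : y = a
      · subst hya
        by_cases hxy : x = y <;> simp [cofMat, Matrix.diagonal_apply, hxy, hxb]
      · by_cases hxy : x = y
        · subst hxy; simp [cofMat, hxb, hya]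
        · simp [cofMat, hxb, hya, hxy]
  rw [h, det_add_diag]
  have hs : ∀ Q : Finset α, Q ∈ ((Finset.univ : Finset α) \ {a, b}).powerset ↔
      (∀ x ∈ Q, ¬ (x = a ∨ x = b)) := by
    intro Q
    simp only [Finset.mem_powerset, Finset.subset_iff, Finset.mem_sdiff, Finset.mem_univ,
      true_and, Finset.mem_insert, Finset.mem_singleton]
  rw [← Finset.sum_subset (Finset.subset_univ
    (((Finset.univ : Finset α) \ {a, b}).powerset.image compl))]
  · rw [Finset.sum_image (fun x _ y _ hxy => compl_injective hxy)]
    refine Finset.sum_congr rfl fun Q hQ => ?_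
    rw [compl_compl, cofDet_eq, mul_comm, ← Finset.compl_eq_univ_sdiff]
    congr 1
    exact Finset.prod_congr rfl fun x hx => if_neg ((hs Q).1 hQ x hx)
  · intro s _ hsn
    have : sᶜ ∉ ((Finset.univ : Finset α) \ {a, b}).powerset := by
      intro h'
      exact hsn (Finset.mem_image.2 ⟨sᶜ, h', compl_compl s⟩)
    rw [hs] at this
    push Not at this
    obtain ⟨x, hx, hx'⟩ := this
    rw [Finset.prod_eq_zero hx (by simp [hx']), zero_mul]

lemma inv_apply_eq {α : Type*} [Fintype α] [DecidableEq α] (S : Finset α) (M : Matrix α α ℂ)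
    (a b : α) (ha : a ∈ S) (hb : b ∈ S) :
    (Matrix.of fun x y : S => M x y)⁻¹ ⟨a, ha⟩ ⟨b, hb⟩
      = ((Matrix.of fun x y : S => M x y).det)⁻¹ * cofDet S M a b := by
  rw [Matrix.inv_def, Matrix.smul_apply, Matrix.adjugate_apply, Ring.inverse_eq_inv', smul_eq_mul]
  congr 1
  rw [cofDet, Matrix.det_apply, Matrix.det_apply]
  refine Finset.sum_congr rfl fun σ _ => ?_
  congr 1
  by_cases hσ : σ ⟨a, ha⟩ = ⟨b, hb⟩
  · refine Finset.prod_congr rfl fun i _ => ?_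
    by_cases hi : i = ⟨a, ha⟩
    · subst hi
      simp [hσ]
    · have h1 : σ i ≠ ⟨b, hb⟩ := fun h => hi (σ.injective (h.trans hσ.symm))
      have h2 : (σ i : α) ≠ b := fun h => h1 (Subtype.ext h)
      have h3 : (i : α) ≠ a := fun h => hi (Subtype.ext h)
      simp [Matrix.updateRow_apply, h1, h2, h3]
  · have hj : σ⁻¹ ⟨b, hb⟩ ≠ ⟨a, ha⟩ := fun h => hσ (by rw [← h]; simp)
    have hj' : ((σ⁻¹ ⟨b, hb⟩ : S) : α) ≠ a := fun h => hj (Subtype.ext h)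
    simp only [Equiv.Perm.inv_def] at hj hj'
    rw [Finset.prod_eq_zero (Finset.mem_univ (σ⁻¹ ⟨b, hb⟩)),
      Finset.prod_eq_zero (Finset.mem_univ (σ⁻¹ ⟨b, hb⟩))]
    · simp [hj']
    · simp [hj]

lemma det_rec {α : Type*} [Fintype α] [DecidableEq α] (S : Finset α) (B : Matrix α α ℂ)
    (c : α) (L : α → ℂ) (J : ℂ)
    (h : (rowRep S B).mulVec L = Pi.single c J) :
    (rowRep S B).det * L c = J * (rowRep (S.erase c) B).det := by
  have h1 := congrArg (fun w => (rowRep S B).adjugate.mulVec w c) h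
  simp only [Matrix.mulVec_mulVec, Matrix.adjugate_mul] at h1
  rw [Matrix.smul_mulVec, Matrix.one_mulVec] at h1
  simp only [Pi.smul_apply, smul_eq_mul, Matrix.mulVec_single] at h1
  rw [h1]
  simp only [Matrix.adjugate_apply, MulOpposite.smul_eq_mul_unop, Matrix.col_apply,
    MulOpposite.unop_op]
  rw [mul_comm]
  congr 2
  ext x y
  by_cases hx : x = c
  · subst hx; simp [rowRep, Pi.single_apply, eq_comm]
  · simp [rowRep, Matrix.updateRow_apply, hx]

/-! ### The torus measure -/

/-- Normalised Lebesgue measure on `[0, 2π]`. -/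
def nuT : Measure ℝ :=
  (ENNReal.ofReal (2 * Real.pi))⁻¹ • (volume.restrict (Set.Icc (0:ℝ) (2 * Real.pi)))

instance : IsProbabilityMeasure nuT := by
  constructor
  have h : (0:ℝ) < 2 * Real.pi := by positivity
  simp only [nuT, Measure.smul_apply, Measure.restrict_apply_univ, Real.volume_Icc, sub_zero,
    smul_eq_mul]
  exact ENNReal.inv_mul_cancel (by simpa using h) ENNReal.ofReal_ne_top

/-- Product measure on the torus. -/
def muT (α : Type*) [Fintype α] : Measure (α → ℝ) := Measure.pi fun _ => nuT

instance (α : Type*) [Fintype α] : IsProbabilityMeasure (muT α) := by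
  unfold muT; infer_instance

lemma muT_eq (α : Type*) [Fintype α] : muT α =
    ((ENNReal.ofReal (2 * Real.pi))⁻¹ ^ Fintype.card α) •
      (volume.restrict (Set.univ.pi (fun _ : α => Set.Icc (0:ℝ) (2 * Real.pi)))) := by
  unfold muT
  refine Measure.pi_eq fun s hs => ?_
  rw [volume_pi, Measure.restrict_pi_pi]
  simp only [nuT, Measure.smul_apply, Measure.pi_pi, smul_eq_mul, Finset.prod_mul_distrib,
    Finset.prod_const, Finset.card_univ]

lemma integrable_muT {α : Type*} [Fintype α] {E : Type*} [NormedAddCommGroup E]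
    {f : (α → ℝ) → E} (hf : Continuous f) :
    Integrable f (muT α) := by
  rw [muT_eq]
  refine Integrable.smul_measure ?_ ?_
  · exact hf.continuousOn.integrableOn_compact (isCompact_univ_pi fun _ => isCompact_Icc)
  · have h : (0:ℝ) < 2 * Real.pi := by positivity
    refine ENNReal.pow_ne_top (ENNReal.inv_ne_top.2 (by simpa using h))

lemma integral_muT {α : Type*} [Fintype α] (f : (α → ℝ) → ℂ) :
    ∫ θ, f θ ∂(muT α) = ((2 * Real.pi : ℂ) ^ (Fintype.card α))⁻¹ *
      ∫ θ in Set.univ.pi (fun _ : α => Set.Icc (0:ℝ) (2 * Real.pi)), f θ := by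
  have h : (0:ℝ) < 2 * Real.pi := by positivity
  rw [muT_eq, integral_smul_measure]
  rw [ENNReal.toReal_pow, ENNReal.toReal_inv, ENNReal.toReal_ofReal h.le, Complex.real_smul]
  push_cast
  rw [inv_pow]

/-- Splitting off one coordinate. -/
lemma measurePreserving_update {α : Type*} [Fintype α] [DecidableEq α] (a : α) :
    MeasurePreserving (fun p : (α → ℝ) × ℝ => Function.update p.1 a p.2)
      ((muT α).prod nuT) (muT α) := by
  have hm : Measurable (fun p : (α → ℝ) × ℝ => Function.update p.1 a p.2) := by
    refine measurable_pi_lambda _ fun x => ?_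
    by_cases hx : x = a
    · subst hx; simpa using measurable_snd
    · simp only [Function.update_of_ne hx]
      fun_prop
  refine ⟨hm, ?_⟩
  unfold muT
  symm
  refine Measure.pi_eq fun s hs => ?_
  rw [Measure.map_apply hm (MeasurableSet.univ_pi hs)]
  have h1 : (fun p : (α → ℝ) × ℝ => Function.update p.1 a p.2) ⁻¹' (Set.univ.pi s)
      = (Set.univ.pi (Function.update s a Set.univ)) ×ˢ (s a) := by
    ext ⟨θ, t⟩
    simp only [Set.mem_preimage, Set.mem_pi, Set.mem_univ, true_implies, Set.mem_prod]
    constructor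
    · intro h
      refine ⟨fun x => ?_, by simpa using h a⟩
      by_cases hx : x = a
      · subst hx; simp
      · simpa [hx] using h x
    · rintro ⟨h, h'⟩ x
      by_cases hx : x = a
      · subst hx; simpa using h'
      · simpa [hx] using h x
  rw [h1, Measure.prod_prod, Measure.pi_pi, ← Finset.mul_prod_erase _ _ (Finset.mem_univ a),
    ← Finset.mul_prod_erase (a := a) Finset.univ (fun i => nuT (s i)) (Finset.mem_univ a)]
  simp only [Function.update_self, measure_univ, one_mul]
  rw [mul_comm]
  congr 1
  refine Finset.prod_congr rfl fun x hx => ?_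
  rw [Function.update_of_ne (Finset.ne_of_mem_erase hx)]

lemma integral_update {α : Type*} [Fintype α] [DecidableEq α] (a : α) {f : (α → ℝ) → ℂ}
    (hf : Continuous f) :
    ∫ θ, f θ ∂(muT α) = ∫ θ, ∫ t, f (Function.update θ a t) ∂nuT ∂(muT α) := by
  have hmp := measurePreserving_update (α := α) a
  have hi := integrable_muT hf
  have hi2 : Integrable (fun p : (α → ℝ) × ℝ => f (Function.update p.1 a p.2))
      ((muT α).prod nuT) := hmp.integrable_comp_of_integrable hi
  rw [← integral_prod _ hi2]
  rw [← hmp.map_eq, integral_map hmp.measurable.aemeasurable hf.aestronglyMeasurable, hmp.map_eq]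

lemma integral_nuT (f : ℂ → ℂ) (r : ℝ) :
    ∫ t, f (r * Complex.exp (-(Complex.I * (t:ℂ)))) ∂nuT = Real.circleAverage f 0 r := by
  have h : (0:ℝ) < 2 * Real.pi := by positivity
  rw [nuT, integral_smul_measure, ENNReal.toReal_inv, ENNReal.toReal_ofReal h.le,
    Real.circleAverage, integral_Icc_eq_integral_Ioc, ← intervalIntegral.integral_of_le h.le]
  congr 1
  have h1 : ∀ t : ℝ, f (r * Complex.exp (-(Complex.I * (t:ℂ)))) = f (circleMap 0 r (-t)) := by
    intro t
    simp [circleMap, mul_comm]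
  simp only [h1]
  rw [intervalIntegral.integral_comp_neg (fun t => f (circleMap 0 r t))]
  have hp : Function.Periodic (fun t => f (circleMap 0 r t)) (2 * Real.pi) :=
    fun t => by simp [periodic_circleMap 0 r t]
  have := hp.intervalIntegral_add_eq (-(2 * Real.pi)) 0
  simpa using this

/-- Mean value property on the unit disc. -/
lemma integral_nuT_disc (f : ℂ → ℂ)
    (hf : ∀ ζ : ℂ, ‖ζ‖ ≤ 1 → DifferentiableAt ℂ f ζ) :
    ∫ t, f (Complex.exp (-(Complex.I * ((t:ℝ):ℂ)))) ∂nuT = f 0 := by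
  have := integral_nuT f 1
  simp only [Complex.ofReal_one, one_mul] at this
  rw [this]
  refine DiffContOnCl.circleAverage ?_
  refine DifferentiableOn.diffContOnCl fun ζ hζ => (hf ζ ?_).differentiableWithinAt
  have := Metric.closure_ball_subset_closedBall hζ
  simpa using this

/-- Independence of the radius. -/
lemma integral_nuT_radius (f : ℂ → ℂ) (hf : ∀ ζ : ℂ, ζ ≠ 0 → DifferentiableAt ℂ f ζ)
    (r : ℝ) (hr : 0 < r) :
    ∫ t, f (r * Complex.exp (-(Complex.I * ((t:ℝ):ℂ)))) ∂nuT
      = ∫ t, f (Complex.exp (-(Complex.I * ((t:ℝ):ℂ)))) ∂nuT := by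
  have key : ∀ r R : ℝ, 0 < r → r ≤ R → Real.circleAverage f 0 R = Real.circleAverage f 0 r := by
    intro r R hr hrR
    rw [Real.circleAverage_eq_circleIntegral hr.ne',
      Real.circleAverage_eq_circleIntegral (hr.trans_le hrR).ne']
    congr 1
    refine Complex.circleIntegral_sub_center_inv_smul_eq_of_differentiable_on_annulus_off_countable
      hr hrR Set.countable_empty ?_ ?_
    · intro ζ hζ
      refine (hf ζ ?_).continuousAt.continuousWithinAt
      rintro rfl
      exact hζ.2 (by simpa using hr)
    · intro ζ hζ
      refine hf ζ ?_
      rintro rfl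
      exact hζ.1.2 (by simpa using hr.le)
  have h1 := integral_nuT f 1
  simp only [Complex.ofReal_one, one_mul] at h1
  rw [h1, integral_nuT f r]
  rcases le_total r 1 with h | h
  · exact (key r 1 hr h).symm
  · exact key 1 r one_pos h

/-! ### The integrand on the torus -/

/-- The point of the torus with angles `-θ`. -/
def zT {α : Type*} (θ : α → ℝ) (x : α) : ℂ := Complex.exp (-(Complex.I * (θ x : ℂ)))

/-- `u_x(z) = z_x⁻¹ (M z)_x`. -/
def uT {α : Type*} [Fintype α] (M : Matrix α α ℂ) (z : α → ℂ) (x : α) : ℂ :=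
  (z x)⁻¹ * ∑ y, M x y * z y

lemma zT_ne {α : Type*} (θ : α → ℝ) (x : α) : zT θ x ≠ 0 := Complex.exp_ne_zero _

lemma norm_zT {α : Type*} (θ : α → ℝ) (x : α) : ‖zT θ x‖ = 1 := by
  simp [zT, Complex.norm_exp]

lemma continuous_zT {α : Type*} (x : α) : Continuous (fun θ : α → ℝ => zT θ x) := by
  unfold zT; fun_prop

lemma continuous_uT {α : Type*} [Fintype α] (M : Matrix α α ℂ) (s : α → ℂ) (hs : ∀ x, s x ≠ 0)
    (x : α) : Continuous (fun θ : α → ℝ => uT M (fun y => s y * zT θ y) x) := by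
  unfold uT
  refine Continuous.mul (Continuous.inv₀ ?_ fun θ => mul_ne_zero (hs x) (zT_ne θ x)) ?_
  · exact continuous_const.mul (continuous_zT x)
  · refine continuous_finsetSum _ fun y _ => ?_
    exact continuous_const.mul (continuous_const.mul (continuous_zT y))

lemma continuous_uT' {α : Type*} [Fintype α] (M : Matrix α α ℂ)
    (x : α) : Continuous (fun θ : α → ℝ => uT M (zT θ) x) := by
  simpa using continuous_uT M (fun _ => 1) (fun _ => one_ne_zero) x

lemma diff_update {α : Type*} [DecidableEq α] (w : α → ℂ) (a x : α) (ζ : ℂ) :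
    DifferentiableAt ℂ (fun ζ : ℂ => Function.update w a ζ x) ζ := by
  by_cases hx : x = a
  · subst hx; simp
  · simp [Function.update_of_ne hx]

lemma diff_uT {α : Type*} [Fintype α] [DecidableEq α] (M : Matrix α α ℂ) (w : α → ℂ) (a x : α)
    (ζ : ℂ) (h : Function.update w a ζ x ≠ 0) :
    DifferentiableAt ℂ (fun ζ : ℂ => uT M (Function.update w a ζ) x) ζ := by
  unfold uT
  refine DifferentiableAt.mul ((diff_update w a x ζ).inv h) ?_
  refine DifferentiableAt.fun_sum fun y _ => ?_
  exact (differentiableAt_const _).mul (diff_update w a y ζ)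

lemma zT_update {α : Type*} [DecidableEq α] (θ : α → ℝ) (a : α) (t : ℝ) :
    zT (Function.update θ a t)
      = Function.update (zT θ) a (Complex.exp (-(Complex.I * (t:ℂ)))) := by
  funext x
  by_cases hx : x = a
  · subst hx; simp [zT]
  · simp [zT, hx]

/-- `Φ(s)`: the torus integral over radii `s`. -/
def PhiT {α : Type*} [Fintype α] (M : Matrix α α ℂ) (l s : α → ℝ) : ℂ :=
  ∫ θ, Complex.exp (∑ x, (l x : ℂ) * uT M (fun y => (s y : ℂ) * zT θ y) x) ∂(muT α)

lemma PhiT_update {α : Type*} [Fintype α] [DecidableEq α] (M : Matrix α α ℂ) (l s : α → ℝ)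
    (hs : ∀ x, 0 < s x) (a : α) :
    PhiT M l (Function.update s a 1) = PhiT M l s := by
  have hs' : ∀ x, 0 < Function.update s a 1 x := by
    intro x
    by_cases hx : x = a
    · subst hx; simp
    · simpa [hx] using hs x
  have hcont : ∀ s : α → ℝ, (∀ x, 0 < s x) → Continuous (fun θ : α → ℝ =>
      Complex.exp (∑ x, (l x : ℂ) * uT M (fun y => (s y : ℂ) * zT θ y) x)) := by
    intro s hs
    refine Complex.continuous_exp.comp (continuous_finsetSum _ fun x _ => ?_)
    refine continuous_const.mul (continuous_uT M (fun y => (s y : ℂ)) (fun y => ?_) x)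
    exact_mod_cast (hs y).ne'
  unfold PhiT
  rw [integral_update a (hcont _ hs), integral_update a (hcont _ hs')]
  congr 1
  funext θ
  have h1 : ∀ (q r : ℝ) (t : ℝ), (fun y => ((Function.update s a r y : ℝ) : ℂ) *
      zT (Function.update θ a t) y) = Function.update (fun y => (s y : ℂ) * zT θ y) a
        (r * Complex.exp (-(Complex.I * (t:ℂ)))) := by
    intro q r t
    funext y
    rw [zT_update]
    by_cases hy : y = a
    · subst hy; simp
    · simp [hy]
  have h2 : ∀ (t : ℝ), (fun y => (s y : ℂ) *
      zT (Function.update θ a t) y) = Function.update (fun y => (s y : ℂ) * zT θ y) a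
        ((s a) * Complex.exp (-(Complex.I * (t:ℂ)))) := by
    intro t
    rw [← h1 0]
    simp
  simp only [h1 0, h2, Complex.ofReal_one, one_mul]
  refine (integral_nuT_radius (fun ζ => Complex.exp (∑ x, (l x : ℂ) *
    uT M (Function.update (fun y => (s y : ℂ) * zT θ y) a ζ) x)) ?_ (s a) (hs a)).symm
  intro ζ hζ
  refine DifferentiableAt.cexp (DifferentiableAt.fun_sum fun x _ => ?_)
  refine (differentiableAt_const _).mul (diff_uT _ _ _ _ _ ?_)
  by_cases hx : x = a
  · subst hx; simpa using hζ
  · simp only [Function.update_of_ne hx]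
    exact mul_ne_zero (by exact_mod_cast (hs x).ne') (zT_ne _ _)

lemma PhiT_one {α : Type*} [Fintype α] [DecidableEq α] (M : Matrix α α ℂ) (l s : α → ℝ)
    (hs : ∀ x, 0 < s x) : PhiT M l s = PhiT M l (fun _ => 1) := by
  have key : ∀ T : Finset α, PhiT M l (T.piecewise (fun _ => 1) s) = PhiT M l s := by
    intro T
    induction T using Finset.induction_on with
    | empty => simp
    | insert a T ha ih =>
      rw [Finset.piecewise_insert, PhiT_update, ih]
      intro x
      by_cases hx : x ∈ T
      · simp [hx]
      · simpa [hx] using hs x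
  rw [← key Finset.univ, Finset.piecewise_univ]

lemma GM_eq {α : Type*} [Fintype α] [DecidableEq α] (A : Matrix α α ℝ) (l : α → ℝ)
    (hl : ∀ x, 0 < l x) :
    GM A l = ∫ θ, Complex.exp (∑ x, (l x : ℂ) * uT (A.map (fun r => (r : ℂ))) (zT θ) x)
      ∂(muT α) := by
  have h1 := PhiT_one (A.map (fun r => (r : ℂ))) l (fun x => Real.sqrt (l x))
    (fun x => Real.sqrt_pos.2 (hl x))
  unfold PhiT at h1
  simp only [Complex.ofReal_one, one_mul] at h1
  rw [show (∫ θ, Complex.exp (∑ x, (l x : ℂ) * uT (A.map (fun r => (r : ℂ))) (zT θ) x)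
      ∂(muT α)) = _ from h1.symm, GM, ← integral_muT]
  congr 1
  funext θ
  congr 1
  refine Finset.sum_congr rfl fun x _ => ?_
  rw [uT, Finset.mul_sum, Finset.mul_sum]
  refine Finset.sum_congr rfl fun y _ => ?_
  have hsx : (Real.sqrt (l x) : ℂ) ≠ 0 := by exact_mod_cast (Real.sqrt_pos.2 (hl x)).ne'
  have hlx : (l x : ℂ) = (Real.sqrt (l x) : ℂ) * (Real.sqrt (l x) : ℂ) := by
    exact_mod_cast (Real.mul_self_sqrt (hl x).le).symm
  have he : Complex.exp (Complex.I * ((θ x : ℂ) - (θ y : ℂ))) = (zT θ x)⁻¹ * zT θ y := by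
    rw [zT, zT, ← Complex.exp_neg, ← Complex.exp_add]
    congr 1; ring
  rw [he, hlx, Real.sqrt_mul (hl x).le]
  have hz := zT_ne θ x
  simp only [Matrix.map_apply, Complex.ofReal_mul]
  field_simp

lemma uT_re_nonpos {α : Type*} [Fintype α] [DecidableEq α] (A : Matrix α α ℝ)
    (hA_offdiag : ∀ x y, x ≠ y → 0 ≤ A x y)
    (hA_rowsum : ∀ x, ∑ y, A x y = 0) (z : α → ℂ) (x : α) (hx : ‖z x‖ = 1)
    (hz : ∀ y, ‖z y‖ ≤ 1) : (uT (A.map (fun r => (r : ℂ))) z x).re ≤ 0 := by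
  have hne : z x ≠ 0 := by intro h; simp [h] at hx
  rw [uT, Finset.mul_sum, Complex.re_sum, ← hA_rowsum x]
  refine Finset.sum_le_sum fun y _ => ?_
  have h1 : (z x)⁻¹ * (A.map (fun r => (r : ℂ)) x y * z y) = (A x y : ℂ) * ((z x)⁻¹ * z y) := by
    simp only [Matrix.map_apply]; ring
  rw [h1, Complex.re_ofReal_mul]
  by_cases hxy : x = y
  · subst hxy
    rw [inv_mul_cancel₀ hne]; simp
  · have h2 : ((z x)⁻¹ * z y).re ≤ 1 := by
      refine (Complex.re_le_norm _).trans ?_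
      rw [norm_mul, norm_inv, hx]; simpa using hz y
    nlinarith [hA_offdiag x y hxy]

/-! ### The master formula on the torus -/

lemma torus_vanish {α : Type*} [Fintype α] [DecidableEq α] (B : Matrix α α ℂ)
    (hB : ∀ (z : α → ℂ) (x : α), ‖z x‖ = 1 → (∀ y, ‖z y‖ ≤ 1) → uT B z x ≠ 0)
    (T : Finset α) (a c : α) (haT : a ∉ T) (hac : a ≠ c) :
    ∫ θ, (zT θ c)⁻¹ * zT θ a * ∏ x ∈ T, (uT B (zT θ) x)⁻¹ ∂(muT α) = 0 := by
  have hcont : Continuous (fun θ : α → ℝ =>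
      (zT θ c)⁻¹ * zT θ a * ∏ x ∈ T, (uT B (zT θ) x)⁻¹) := by
    refine (((continuous_zT c).inv₀ fun θ => zT_ne θ c).mul (continuous_zT a)).mul ?_
    refine continuous_finsetProd _ fun x _ => ?_
    exact (continuous_uT' B x).inv₀ fun θ => hB _ _ (norm_zT θ x) fun y => (norm_zT θ y).le
  rw [integral_update a hcont]
  have : ∀ θ : α → ℝ, ∫ t, (zT (Function.update θ a t) c)⁻¹ * zT (Function.update θ a t) a *
      ∏ x ∈ T, (uT B (zT (Function.update θ a t)) x)⁻¹ ∂nuT = 0 := by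
    intro θ
    simp only [zT_update]
    rw [integral_nuT_disc (fun ζ => (Function.update (zT θ) a ζ c)⁻¹ * Function.update (zT θ) a ζ a *
      ∏ x ∈ T, (uT B (Function.update (zT θ) a ζ) x)⁻¹)]
    · simp
    · intro ζ hζ
      refine DifferentiableAt.mul (DifferentiableAt.mul ((diff_update _ _ _ _).inv ?_)
        (diff_update _ _ _ _)) ?_
      · rw [Function.update_of_ne hac.symm]; exact zT_ne θ c
      · refine DifferentiableAt.fun_finsetProd fun x hx => ?_
        have hxa : x ≠ a := fun h => haT (h ▸ hx)
        refine (diff_uT _ _ _ _ _ ?_).inv (hB _ _ ?_ ?_)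
        · rw [Function.update_of_ne hxa]; exact zT_ne θ x
        · rw [Function.update_of_ne hxa]; exact norm_zT θ x
        · intro y
          by_cases hy : y = a
          · subst hy; simpa using hζ
          · rw [Function.update_of_ne hy]; exact (norm_zT θ y).le
  simp only [this, integral_zero]

lemma torus_master {α : Type*} [Fintype α] [DecidableEq α] (B : Matrix α α ℂ)
    (hB : ∀ (z : α → ℂ) (x : α), ‖z x‖ = 1 → (∀ y, ‖z y‖ ≤ 1) → uT B z x ≠ 0)
    (S : Finset α) :
    (rowRep S B).det * ∫ θ, ∏ x ∈ S, (uT B (zT θ) x)⁻¹ ∂(muT α) = 1 := by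
  induction S using Finset.induction_on with
  | empty =>
    have : rowRep ∅ B = 1 := by ext x y; simp [rowRep, Matrix.one_apply]
    simp [this]
  | insert c S hc ih =>
    set S' := insert c S with hS'
    have hne : ∀ (θ : α → ℝ) x, uT B (zT θ) x ≠ 0 :=
      fun θ x => hB _ _ (norm_zT θ x) fun y => (norm_zT θ y).le
    have hcont : ∀ b : α, Continuous (fun θ : α → ℝ =>
        (zT θ c)⁻¹ * zT θ b * ∏ x ∈ S', (uT B (zT θ) x)⁻¹) := by
      intro b
      refine (((continuous_zT c).inv₀ fun θ => zT_ne θ c).mul (continuous_zT b)).mul ?_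
      refine continuous_finsetProd _ fun x _ => ?_
      exact (continuous_uT' B x).inv₀ fun θ => hne θ x
    have key := det_rec S' B c
      (fun b => ∫ θ, (zT θ c)⁻¹ * zT θ b * ∏ x ∈ S', (uT B (zT θ) x)⁻¹ ∂(muT α))
      (∫ θ, ∏ x ∈ S, (uT B (zT θ) x)⁻¹ ∂(muT α)) ?_
    · have h1 : S'.erase c = S := by rw [hS', Finset.erase_insert hc]
      rw [h1, mul_comm (∫ θ, ∏ x ∈ S, (uT B (zT θ) x)⁻¹ ∂(muT α)), ih] at key
      rw [← key]
      congr 2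
      funext θ
      rw [inv_mul_cancel₀ (zT_ne θ c), one_mul]
    · funext a
      by_cases haS : a ∈ S'
      · have h2 : (rowRep S' B).mulVec
            (fun b => ∫ θ, (zT θ c)⁻¹ * zT θ b * ∏ x ∈ S', (uT B (zT θ) x)⁻¹ ∂(muT α)) a
            = ∫ θ, (zT θ c)⁻¹ * zT θ a * ∏ x ∈ S'.erase a, (uT B (zT θ) x)⁻¹ ∂(muT α) := by
          simp only [Matrix.mulVec, dotProduct, rowRep, Matrix.of_apply, if_pos haS]
          simp only [← integral_const_mul]
          rw [← integral_finsetSum _ fun b _ => (integrable_muT (hcont b)).const_mul _]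
          congr 1
          funext θ
          rw [← Finset.mul_prod_erase S' _ haS]
          have h3 : ∑ b, B a b * zT θ b = zT θ a * uT B (zT θ) a := by
            rw [uT, mul_inv_cancel_left₀ (zT_ne θ a)]
          have h4 : ∑ b, B a b * ((zT θ c)⁻¹ * zT θ b *
              ((uT B (zT θ) a)⁻¹ * ∏ x ∈ S'.erase a, (uT B (zT θ) x)⁻¹))
              = (∑ b, B a b * zT θ b) * ((zT θ c)⁻¹ *
              ((uT B (zT θ) a)⁻¹ * ∏ x ∈ S'.erase a, (uT B (zT θ) x)⁻¹)) := by
            rw [Finset.sum_mul]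
            exact Finset.sum_congr rfl fun b _ => by ring
          rw [h4, h3]
          have := hne θ a
          field_simp
        rw [h2]
        by_cases hac : a = c
        · subst hac
          rw [Pi.single_eq_same, hS', Finset.erase_insert hc]
          congr 1
          funext θ
          rw [inv_mul_cancel₀ (zT_ne θ a), one_mul]
        · rw [Pi.single_eq_of_ne hac]
          exact torus_vanish B hB _ a c (Finset.notMem_erase a S') hac
      · have hac : a ≠ c := by rintro rfl; exact haS (Finset.mem_insert_self _ _)
        rw [Pi.single_eq_of_ne hac]
        simp only [Matrix.mulVec, dotProduct, rowRep, Matrix.of_apply, if_neg haS, ite_mul,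
          one_mul, zero_mul, Finset.sum_ite_eq, Finset.mem_univ, if_true]
        exact torus_vanish B hB _ a c haS hac

/-! ### Derivatives -/

lemma pd_integral {α : Type*} [Fintype α] [DecidableEq α] (p : (α → ℝ) → ℂ) (hp : Continuous p)
    (u : (α → ℝ) → α → ℂ) (hu : ∀ x, Continuous fun θ => u θ x) (x : α) :
    pd x (fun l => ∫ θ, p θ * Complex.exp (∑ x, (l x : ℂ) * u θ x) ∂(muT α))
      = fun l => ∫ θ, (u θ x * p θ) * Complex.exp (∑ x, (l x : ℂ) * u θ x) ∂(muT α) := by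
  funext l₀
  let P : α → ((α → ℝ) →L[ℝ] ℂ) := fun y =>
    Complex.ofRealCLM.comp (ContinuousLinearMap.proj (R := ℝ) (φ := fun _ : α => ℝ) y)
  let F' : (α → ℝ) → (α → ℝ) → ((α → ℝ) →L[ℝ] ℂ) := fun l θ =>
    (p θ * Complex.exp (∑ x, (l x : ℂ) * u θ x)) • ∑ y, u θ y • P y
  have hFc : ∀ l : α → ℝ, Continuous
      (fun θ => p θ * Complex.exp (∑ x, (l x : ℂ) * u θ x)) := by
    intro l
    refine hp.mul (Complex.continuous_exp.comp (continuous_finsetSum _ fun x _ => ?_))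
    exact continuous_const.mul (hu x)
  have hF'c : ∀ l : α → ℝ, Continuous (F' l) := by
    intro l
    refine (hFc l).smul (continuous_finsetSum _ fun y _ => ?_)
    exact (hu y).smul continuous_const
  have hd : HasFDerivAt (fun l : α → ℝ =>
      ∫ θ, p θ * Complex.exp (∑ x, (l x : ℂ) * u θ x) ∂(muT α))
      (∫ θ, F' l₀ θ ∂(muT α)) l₀ := by
    refine hasFDerivAt_integral_of_dominated_of_fderiv_le
      (bound := fun θ => (‖p θ‖ * Real.exp (∑ x, (|l₀ x| + 1) * ‖u θ x‖)) *
        ∑ y, ‖u θ y‖ * ‖P y‖) (Metric.ball_mem_nhds l₀ one_pos) ?_ ?_ ?_ ?_ ?_ ?_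
    · exact Filter.Eventually.of_forall fun l => (hFc l).aestronglyMeasurable
    · exact integrable_muT (hFc l₀)
    · exact (hF'c l₀).aestronglyMeasurable
    · refine Filter.Eventually.of_forall fun θ l hl => ?_
      have hl' : ∀ y, |l y| ≤ |l₀ y| + 1 := by
        intro y
        have h1 : ‖(l - l₀) y‖ ≤ 1 := (norm_le_pi_norm (l - l₀) y).trans
          (by rw [← dist_eq_norm]; exact (Metric.mem_ball.1 hl).le)
        have h2 : |l y - l₀ y| ≤ 1 := h1
        have h3 := abs_sub_abs_le_abs_sub (l y) (l₀ y)
        linarith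
      simp only [F']
      rw [norm_smul, norm_mul]
      have hs : ‖∑ y, u θ y • P y‖ ≤ ∑ y, ‖u θ y‖ * ‖P y‖ :=
        (norm_sum_le _ _).trans (Finset.sum_le_sum fun y _ => (norm_smul (u θ y) (P y)).le)
      have he : ‖Complex.exp (∑ x, (l x : ℂ) * u θ x)‖
          ≤ Real.exp (∑ x, (|l₀ x| + 1) * ‖u θ x‖) := by
        rw [Complex.norm_exp]
        refine Real.exp_le_exp.2 ((Complex.re_le_norm _).trans ((norm_sum_le _ _).trans ?_))
        refine Finset.sum_le_sum fun y _ => ?_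
        rw [norm_mul, Complex.norm_real]
        exact mul_le_mul_of_nonneg_right (hl' y) (norm_nonneg _)
      gcongr
    · refine integrable_muT ?_
      refine (hp.norm.mul (Real.continuous_exp.comp (continuous_finsetSum _ fun y _ => ?_))).mul
        (continuous_finsetSum _ fun y _ => ?_)
      · exact continuous_const.mul (hu y).norm
      · exact (hu y).norm.mul continuous_const
    · refine Filter.Eventually.of_forall fun θ l _ => ?_
      have h1 : HasFDerivAt (fun l : α → ℝ => ∑ x, (l x : ℂ) * u θ x) (∑ y, u θ y • P y) l := by
        refine HasFDerivAt.fun_sum fun y _ => ?_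
        have : HasFDerivAt (fun l : α → ℝ => (l y : ℂ)) (P y) l := (P y).hasFDerivAt
        exact this.mul_const (u θ y)
      have h2 := (h1.cexp).const_mul (p θ)
      refine h2.congr_fderiv ?_
      exact (mul_smul (p θ) (Complex.exp (∑ x, (l x : ℂ) * u θ x)) (∑ y, u θ y • P y)).symm
  unfold pd
  rw [hd.fderiv, ContinuousLinearMap.integral_apply (integrable_muT (hF'c l₀))]
  congr 1
  funext θ
  have hP : ∀ y, P y (Pi.single x 1) = if y = x then 1 else 0 := by
    intro y
    simp [P, Pi.single_apply, apply_ite]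
  have hF : F' l₀ θ (Pi.single x 1) = (p θ * Complex.exp (∑ x, (l₀ x : ℂ) * u θ x)) *
      ∑ y, u θ y * P y (Pi.single x 1) := by
    simp [F']
  rw [hF]
  simp only [hP, mul_ite, mul_one, mul_zero, Finset.sum_ite_eq', Finset.mem_univ, if_true]
  ring

lemma foldr_pd_integral {α : Type*} [Fintype α] [DecidableEq α]
    (u : (α → ℝ) → α → ℂ) (hu : ∀ x, Continuous fun θ => u θ x) (Ls : List α) :
    Ls.foldr pd (fun l => ∫ θ, Complex.exp (∑ x, (l x : ℂ) * u θ x) ∂(muT α))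
      = fun l => ∫ θ, (Ls.map (u θ)).prod * Complex.exp (∑ x, (l x : ℂ) * u θ x) ∂(muT α) := by
  induction Ls with
  | nil => simp
  | cons x Ls ih =>
    rw [List.foldr_cons, ih, pd_integral _ _ u hu x]
    · simp only [List.map_cons, List.prod_cons]
    · exact continuous_list_prod Ls fun y _ => hu y

lemma foldr_pd_congr {α : Type*} [Fintype α] [DecidableEq α] (U : Set (α → ℝ)) (hU : IsOpen U)
    (f g : (α → ℝ) → ℂ) (hfg : ∀ l ∈ U, f l = g l) (Ls : List α) :
    ∀ l ∈ U, Ls.foldr pd f l = Ls.foldr pd g l := by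
  induction Ls with
  | nil => simpa using hfg
  | cons x Ls ih =>
    intro l hl
    simp only [List.foldr_cons, pd]
    have : (Ls.foldr pd f) =ᶠ[nhds l] (Ls.foldr pd g) :=
      Filter.eventually_of_mem (hU.mem_nhds hl) ih
    rw [this.fderiv_eq]

lemma isOpen_orthant (α : Type*) [Fintype α] :
    IsOpen (Set.univ.pi fun _ : α => Set.Ioi (0:ℝ)) :=
  isOpen_set_pi Set.finite_univ fun _ _ => isOpen_Ioi

lemma rho_eq {α : Type*} [Fintype α] [DecidableEq α] (A : Matrix α α ℝ) (a b : α) (l : α → ℝ)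
    (hl : l ∈ Set.univ.pi fun _ : α => Set.Ioi (0:ℝ)) :
    rho A a b l = ∫ θ, cofDet Finset.univ ((-A).map (fun r => (r : ℂ)) +
        Matrix.diagonal (uT (A.map (fun r => (r : ℂ))) (zT θ))) a b *
      Complex.exp (∑ x, (l x : ℂ) * uT (A.map (fun r => (r : ℂ))) (zT θ) x) ∂(muT α) := by
  have hu := continuous_uT' (A.map (fun r : ℝ => (r : ℂ)))
  have hm : ∀ Q : Finset α, mpart Q (GM A) l = ∫ θ,
      (∏ x ∈ Q, uT (A.map (fun r => (r : ℂ))) (zT θ) x) *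
      Complex.exp (∑ x, (l x : ℂ) * uT (A.map (fun r => (r : ℂ))) (zT θ) x) ∂(muT α) := by
    intro Q
    unfold mpart
    rw [foldr_pd_congr _ (isOpen_orthant α) (GM A) (fun l => ∫ θ, Complex.exp (∑ x, (l x : ℂ) *
      uT (A.map (fun r => (r : ℂ))) (zT θ) x) ∂(muT α)) (fun l hl => GM_eq A l fun x => hl x
        (Set.mem_univ x)) Q.toList l hl,
      foldr_pd_integral (fun θ => uT (A.map (fun r => (r : ℂ))) (zT θ)) hu]
    simp only [Finset.prod_map_toList]
  unfold rho ddet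
  simp only [hm, cofDet_add_diag, ← integral_const_mul]
  rw [← integral_finsetSum]
  · congr 1
    funext θ
    rw [Finset.sum_mul]
    exact Finset.sum_congr rfl fun Q _ => by ring
  · intro Q _
    refine (integrable_muT ?_).const_mul _
    refine (continuous_finsetProd _ fun x _ => hu x).mul
      (Complex.continuous_exp.comp (continuous_finsetSum _ fun x _ => ?_))
    exact continuous_const.mul (hu x)

/-! ### Laplace transform -/

lemma integrable_exp_orthant {α : Type*} [Fintype α] (r : α → ℂ) (hr : ∀ x, (r x).re < 0) :
    Integrable (fun l : α → ℝ => Complex.exp (∑ x, r x * (l x : ℂ)))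
      (volume.restrict (Set.univ.pi fun _ : α => Set.Ioi (0:ℝ))) := by
  rw [volume_pi, Measure.restrict_pi_pi]
  simp only [Complex.exp_sum]
  exact Integrable.fintype_prod (f := fun x (t : ℝ) => Complex.exp (r x * (t : ℂ)))
    fun x => integrableOn_exp_mul_complex_Ioi (hr x) 0

lemma integral_exp_orthant {α : Type*} [Fintype α] (r : α → ℂ) (hr : ∀ x, (r x).re < 0) :
    ∫ l in (Set.univ.pi fun _ : α => Set.Ioi (0:ℝ)), Complex.exp (∑ x, r x * (l x : ℂ))
      = ∏ x, (-(r x))⁻¹ := by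
  rw [volume_pi, Measure.restrict_pi_pi]
  simp only [Complex.exp_sum]
  rw [integral_fintype_prod_eq_prod (fun x (t : ℝ) => Complex.exp (r x * (t : ℂ)))]
  refine Finset.prod_congr rfl fun x _ => ?_
  rw [integral_exp_mul_complex_Ioi (hr x) 0]
  simp [neg_div, inv_neg]

lemma laplace_integrable {α : Type*} [Fintype α] (p : (α → ℝ) → ℂ) (hp : Continuous p)
    (u : (α → ℝ) → α → ℂ) (hu : ∀ x, Continuous fun θ => u θ x)
    (hre : ∀ θ x, (u θ x).re ≤ 0) (v : α → ℂ) (hv : ∀ x, (v x).re < 0) :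
    Integrable (fun q : (α → ℝ) × (α → ℝ) => Complex.exp (∑ x, v x * (q.1 x : ℂ)) *
      (p q.2 * Complex.exp (∑ x, (q.1 x : ℂ) * u q.2 x)))
      ((volume.restrict (Set.univ.pi fun _ : α => Set.Ioi (0:ℝ))).prod (muT α)) := by
  have h1 := (integrable_exp_orthant v hv).mul_prod (integrable_muT hp)
  refine h1.mono ?_ ?_
  · refine Continuous.aestronglyMeasurable ?_
    have hu2 : ∀ x, Continuous fun q : (α → ℝ) × (α → ℝ) => u q.2 x :=
      fun x => (hu x).comp continuous_snd
    have hp2 : Continuous fun q : (α → ℝ) × (α → ℝ) => p q.2 := hp.comp continuous_snd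
    fun_prop
  · have hae : ∀ᵐ q ∂((volume.restrict (Set.univ.pi fun _ : α => Set.Ioi (0:ℝ))).prod (muT α)),
        q.1 ∈ (Set.univ.pi fun _ : α => Set.Ioi (0:ℝ)) :=
      Measure.quasiMeasurePreserving_fst.ae
        (ae_restrict_mem (MeasurableSet.univ_pi fun _ => measurableSet_Ioi))
    filter_upwards [hae] with q hq
    rw [norm_mul, norm_mul, norm_mul]
    refine mul_le_mul_of_nonneg_left ?_ (norm_nonneg _)
    refine mul_le_of_le_one_right (norm_nonneg _) ?_
    rw [Complex.norm_exp, Real.exp_le_one_iff, Complex.re_sum]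
    refine Finset.sum_nonpos fun x _ => ?_
    rw [Complex.re_ofReal_mul]
    exact mul_nonpos_of_nonneg_of_nonpos (le_of_lt (hq x (Set.mem_univ x))) (hre _ _)

lemma laplace_integral {α : Type*} [Fintype α] (p : (α → ℝ) → ℂ) (hp : Continuous p)
    (u : (α → ℝ) → α → ℂ) (hu : ∀ x, Continuous fun θ => u θ x)
    (hre : ∀ θ x, (u θ x).re ≤ 0) (v : α → ℂ) (hv : ∀ x, (v x).re < 0) :
    ∫ l in (Set.univ.pi fun _ : α => Set.Ioi (0:ℝ)), Complex.exp (∑ x, v x * (l x : ℂ)) *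
      ∫ θ, p θ * Complex.exp (∑ x, (l x : ℂ) * u θ x) ∂(muT α)
      = ∫ θ, p θ * ∏ x, (-(v x + u θ x))⁻¹ ∂(muT α) := by
  simp only [← integral_const_mul]
  rw [integral_integral_swap (laplace_integrable p hp u hu hre v hv)]
  congr 1
  funext θ
  rw [← integral_exp_orthant (fun x => v x + u θ x)
    (fun x => by rw [Complex.add_re]; linarith [hv x, hre θ x]), ← integral_const_mul]
  congr 1
  funext l
  rw [mul_left_comm, ← Complex.exp_add, ← Finset.sum_add_distrib]
  congr 3
  funext x
  ring

/-- **Laplace-transform form of the density formula (Steps 1–5 of the proof of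
Theorem 2.1).** For a generator `A` on a finite set `Λ` with at least two elements,
`a, b ∈ Λ` and `v ∈ ℂ^Λ` with `Re v_x < 0`: every submatrix `−(A+V)_{S×S}` (for
`{a,b} ⊆ S`) is invertible, `l ↦ e^{⟨v,l⟩} ρ_{ab}^{(Λ)}(l)` is integrable on `(0,∞)^Λ`,
and `Σ_{S ⊇ {a,b}} (−1)^{|Λ|−|S|} ((−(A+V)_{S×S})⁻¹)_{a,b}
= ∫_{(0,∞)^Λ} e^{⟨v,l⟩} ρ_{ab}^{(Λ)}(l) d^Λ l`. -/
theorem laplace_transform_local_time_density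
    {Λ : Type*} [Fintype Λ] [DecidableEq Λ]
    (hcard : 2 ≤ Fintype.card Λ)
    (A : Matrix Λ Λ ℝ)
    (hA_offdiag : ∀ x y, x ≠ y → 0 ≤ A x y)
    (hA_rowsum : ∀ x, ∑ y, A x y = 0)
    (a b : Λ) (v : Λ → ℂ) (hv : ∀ x, (v x).re < 0)
    (C : Matrix Λ Λ ℂ)
    (hC : C = A.map (fun r => (r : ℂ)) + Matrix.diagonal v) :
    (∀ S : Finset Λ, a ∈ S → b ∈ S →
      IsUnit (Matrix.of fun x y : S => -(C x y))) ∧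
    MeasureTheory.IntegrableOn
      (fun l : Λ → ℝ => Complex.exp (∑ x, v x * (l x : ℂ)) * rho A a b l)
      (Set.univ.pi fun _ : Λ => Set.Ioi (0:ℝ)) ∧
    (∑ S : Finset Λ,
        (if h : a ∈ S ∧ b ∈ S then
          (-1 : ℂ) ^ (Fintype.card Λ - S.card) *
            (Matrix.of fun x y : S => -(C x y))⁻¹ ⟨a, h.1⟩ ⟨b, h.2⟩
        else 0))
      = ∫ l in Set.univ.pi fun _ : Λ => Set.Ioi (0:ℝ),
          Complex.exp (∑ x, v x * (l x : ℂ)) * rho A a b l := by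
  set Ac : Matrix Λ Λ ℂ := A.map (fun r => (r : ℂ)) with hAc
  set B : Matrix Λ Λ ℂ := -C with hBdef
  have hre : ∀ (z : Λ → ℂ) (x : Λ), ‖z x‖ = 1 → (∀ y, ‖z y‖ ≤ 1) → (uT Ac z x).re ≤ 0 :=
    fun z x hx hz => uT_re_nonpos A hA_offdiag hA_rowsum z x hx hz
  have hreT : ∀ (θ : Λ → ℝ) (x : Λ), (uT Ac (zT θ) x).re ≤ 0 :=
    fun θ x => hre _ x (norm_zT θ x) fun y => (norm_zT θ y).le
  have huB : ∀ (z : Λ → ℂ) (x : Λ), z x ≠ 0 → uT B z x = -(v x + uT Ac z x) := by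
    intro z x hx
    have h1 : ∑ y, B x y * z y = -(∑ y, Ac x y * z y) - v x * z x := by
      rw [hBdef, hC]
      simp only [Matrix.neg_apply, Matrix.add_apply, Matrix.diagonal_apply, neg_mul, add_mul,
        ite_mul, zero_mul, Finset.sum_neg_distrib, Finset.sum_add_distrib, Finset.sum_ite_eq,
        Finset.mem_univ, if_true]
      ring
    rw [uT, h1, uT]
    field_simp
    ring
  have hB : ∀ (z : Λ → ℂ) (x : Λ), ‖z x‖ = 1 → (∀ y, ‖z y‖ ≤ 1) → uT B z x ≠ 0 := by
    intro z x hx hz h0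
    have hne : z x ≠ 0 := by intro h; simp [h] at hx
    rw [huB z x hne] at h0
    have h1 := congrArg Complex.re h0
    simp only [Complex.neg_re, Complex.add_re, Complex.zero_re] at h1
    linarith [hv x, hre z x hx hz]
  have hBS : ∀ S : Finset Λ, (Matrix.of fun x y : S => -(C x y)) = Matrix.of fun x y : S => B x y :=
    fun S => rfl
  have hmaster : ∀ S : Finset Λ, (Matrix.of fun x y : S => B x y).det *
      ∫ θ, ∏ x ∈ S, (uT B (zT θ) x)⁻¹ ∂(muT Λ) = 1 := by
    intro S
    rw [← det_rowRep]
    exact torus_master B hB S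
  have hu := continuous_uT' Ac
  have hcof : ∀ θ : Λ → ℝ, cofDet Finset.univ ((-A).map (fun r => (r : ℂ)) +
      Matrix.diagonal (uT Ac (zT θ))) a b =
      ∑ Q ∈ ((Finset.univ : Finset Λ) \ {a, b}).powerset,
        cofDet ((Finset.univ : Finset Λ) \ Q) B a b * ∏ x ∈ Q, (-(uT B (zT θ) x)) := by
    intro θ
    rw [← cofDet_add_diag]
    congr 1
    ext x y
    have hBxy : ∀ x y, B x y = -(Ac x y) - Matrix.diagonal v x y := by
      intro x y
      rw [hBdef, hC]
      simp only [Matrix.neg_apply, Matrix.add_apply]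
      ring
    by_cases hxy : x = y
    · subst hxy
      have h1 := huB (zT θ) x (zT_ne θ x)
      simp only [Matrix.add_apply, Matrix.diagonal_apply_eq, hBxy, h1]
      simp [hAc]
      ring
    · simp [hxy, hBxy, hAc]
  have hpc : Continuous fun θ : Λ → ℝ => cofDet Finset.univ ((-A).map (fun r => (r : ℂ)) +
      Matrix.diagonal (uT Ac (zT θ))) a b := by
    simp only [hcof]
    refine continuous_finsetSum _ fun Q _ => continuous_const.mul
      (continuous_finsetProd _ fun x _ => (continuous_uT' B x).neg)
  have hOm : MeasurableSet (Set.univ.pi fun _ : Λ => Set.Ioi (0:ℝ)) :=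
    MeasurableSet.univ_pi fun _ => measurableSet_Ioi
  have hEq : Set.EqOn (fun l : Λ → ℝ => Complex.exp (∑ x, v x * (l x : ℂ)) * rho A a b l)
      (fun l => Complex.exp (∑ x, v x * (l x : ℂ)) * ∫ θ, cofDet Finset.univ
        ((-A).map (fun r => (r : ℂ)) + Matrix.diagonal (uT Ac (zT θ))) a b *
      Complex.exp (∑ x, (l x : ℂ) * uT Ac (zT θ) x) ∂(muT Λ))
      (Set.univ.pi fun _ : Λ => Set.Ioi (0:ℝ)) := by
    intro l hl
    simp only [rho_eq A a b l hl, hAc]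
  refine ⟨fun S _ _ => ?_, ?_, ?_⟩
  · rw [Matrix.isUnit_iff_isUnit_det, hBS S, isUnit_iff_ne_zero]
    exact left_ne_zero_of_mul_eq_one (hmaster S)
  · rw [integrableOn_congr_fun hEq hOm]
    have := (laplace_integrable _ hpc (fun θ => uT Ac (zT θ)) hu hreT v hv).integral_prod_left
    simp only [integral_const_mul] at this
    exact this
  · rw [setIntegral_congr_fun hOm hEq,
      laplace_integral _ hpc (fun θ => uT Ac (zT θ)) hu hreT v hv]
    have hne : ∀ (θ : Λ → ℝ) x, uT B (zT θ) x ≠ 0 :=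
      fun θ x => hB _ _ (norm_zT θ x) fun y => (norm_zT θ y).le
    have hIntegrand : ∀ θ : Λ → ℝ, cofDet Finset.univ ((-A).map (fun r => (r : ℂ)) +
        Matrix.diagonal (uT Ac (zT θ))) a b * ∏ x, (-(v x + uT Ac (zT θ) x))⁻¹
        = ∑ Q ∈ ((Finset.univ : Finset Λ) \ {a, b}).powerset,
          ((-1) ^ Q.card * cofDet ((Finset.univ : Finset Λ) \ Q) B a b) *
            ∏ x ∈ (Finset.univ : Finset Λ) \ Q, (uT B (zT θ) x)⁻¹ := by
      intro θ
      rw [hcof, Finset.sum_mul]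
      refine Finset.sum_congr rfl fun Q _ => ?_
      have h1 : ∏ x, (-(v x + uT Ac (zT θ) x))⁻¹ = ∏ x, (uT B (zT θ) x)⁻¹ :=
        Finset.prod_congr rfl fun x _ => by rw [huB _ _ (zT_ne θ x)]
      rw [h1, ← Finset.prod_sdiff (Finset.subset_univ Q), Finset.prod_neg]
      have h2 : (∏ x ∈ Q, uT B (zT θ) x) * ∏ x ∈ Q, (uT B (zT θ) x)⁻¹ = 1 := by
        rw [← Finset.prod_mul_distrib]
        exact Finset.prod_eq_one fun x _ => mul_inv_cancel₀ (hne θ x)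
      linear_combination ((-1) ^ Q.card * cofDet ((Finset.univ : Finset Λ) \ Q) B a b *
        ∏ x ∈ (Finset.univ : Finset Λ) \ Q, (uT B (zT θ) x)⁻¹) * h2
    simp only [hIntegrand]
    rw [integral_finsetSum]
    swap
    · intro Q _
      refine (integrable_muT ?_).const_mul _
      refine continuous_finsetProd _ fun x _ => ?_
      exact (continuous_uT' B x).inv₀ fun θ => hne θ x
    simp only [integral_const_mul]
    symm
    have hs : ∀ Q : Finset Λ, Q ∈ ((Finset.univ : Finset Λ) \ {a, b}).powerset ↔
        (a ∉ Q ∧ b ∉ Q) := by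
      intro Q
      simp only [Finset.mem_powerset, Finset.subset_iff, Finset.mem_sdiff, Finset.mem_univ,
        true_and, Finset.mem_insert, Finset.mem_singleton]
      constructor
      · intro h
        exact ⟨fun ha => h ha (Or.inl rfl), fun hb => h hb (Or.inr rfl)⟩
      · rintro ⟨h1, h2⟩ x hx (rfl | rfl)
        · exact h1 hx
        · exact h2 hx
    rw [← Finset.sum_subset (Finset.subset_univ
      (((Finset.univ : Finset Λ) \ {a, b}).powerset.image compl))]
    · rw [Finset.sum_image (fun x _ y _ hxy => compl_injective hxy)]
      refine Finset.sum_congr rfl fun Q hQ => ?_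
      have hab := (hs Q).1 hQ
      have hab' : a ∈ Qᶜ ∧ b ∈ Qᶜ := ⟨Finset.mem_compl.2 hab.1, Finset.mem_compl.2 hab.2⟩
      rw [dif_pos hab', hBS, inv_apply_eq, ← Finset.compl_eq_univ_sdiff, Finset.card_compl]
      have hle : Q.card ≤ Fintype.card Λ := Finset.card_le_univ Q
      have hc : Fintype.card Λ - (Fintype.card Λ - Q.card) = Q.card := by omega
      rw [hc, eq_inv_of_mul_eq_one_right (hmaster Qᶜ)]
      ring
    · intro S _ hSn
      rw [dif_neg]
      intro h
      refine hSn (Finset.mem_image.2 ⟨Sᶜ, (hs _).2 ?_, compl_compl S⟩)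
      simpa using h

end
end

section
/- Let R be a finite set, a, b ∈ R, let A be any real R×R matrix, and let B be its off-diagonal part (B_{x,y} = A_{x,y} for x ≠ y and B_{x,x} = 0). Then for every l ∈ (0,∞)^R: (det_{ab}^{(R)}(−A + ∂_l) G_A)(l) = exp(Σ_{x∈R} l_x A_{x,x}) · (det_{ab}^{(R)}(−B + ∂_l) G_B)(l). -/
open MeasureTheory Finset

noncomputable section

open scoped ContDiff

/-! ### Determinant part -/

/-- Full-size matrix computing `cofDet`. -/
def cofFull {α : Type*} [Fintype α] [DecidableEq α]
    (S : Finset α) (M : Matrix α α ℂ) (a b : α) : Matrix α α ℂ :=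
  Matrix.of fun x y => if x ∈ S then (if x = b then (if y = a then (1:ℂ) else 0)
    else (if y = a then 0 else M x y)) else if x = y then 1 else 0

lemma cofDet_eq_full {α : Type*} [Fintype α] [DecidableEq α]
    (S : Finset α) (M : Matrix α α ℂ) (a b : α) :
    cofDet S M a b = (cofFull S M a b).det := by
  have h2 := Matrix.twoBlockTriangular_det (cofFull S M a b) (fun x => x ∈ S) (by
    intro i hi j hj
    have : i ≠ j := by rintro rfl; exact hi hj
    simp [cofFull, hi, this])
  rw [h2]
  have h3 : (cofFull S M a b).toSquareBlockProp (fun x => ¬ x ∈ S) = 1 := by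
    ext ⟨x, hx⟩ ⟨y, hy⟩
    simp [cofFull, Matrix.toSquareBlockProp, hx, Matrix.one_apply]
  rw [h3, Matrix.det_one, mul_one]
  have h4 : (cofFull S M a b).toSquareBlockProp (fun x => x ∈ S)
      = (Matrix.of fun x y : S => if (x : α) = b then (if (y : α) = a then (1:ℂ) else 0)
        else (if (y : α) = a then 0 else M x y) : Matrix S S ℂ) := by
    ext ⟨x, hx⟩ ⟨y, hy⟩
    simp [cofFull, Matrix.toSquareBlockProp, hx]
  rw [h4, cofDet]
  congr!

lemma cofDet_step {α : Type*} [Fintype α] [DecidableEq α]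
    (S : Finset α) (M : Matrix α α ℂ) (a b x : α) (hx : x ∈ S) (hxa : x ≠ a) (hxb : x ≠ b)
    (d : ℂ) :
    cofDet S (M + Matrix.single x x d) a b = cofDet S M a b + d * cofDet (S.erase x) M a b := by
  simp only [cofDet_eq_full]
  have h1 : cofFull S (M + Matrix.single x x d) a b
      = (cofFull S M a b).updateRow x ((cofFull S M a b) x + d • Pi.single x 1) := by
    ext i j
    by_cases hi : i = x
    · subst hi
      by_cases hj : j = i
      · subst hj
        simp [cofFull, hx, hxa, hxb]
      · have hj' : i ≠ j := fun h => hj h.symm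
        simp [cofFull, hx, hxb, hj, hj', Matrix.single_apply]
    · have hi' : x ≠ i := fun h => hi h.symm
      simp [cofFull, hi, hi', Matrix.single_apply]
  have h2 : cofFull (S.erase x) M a b = (cofFull S M a b).updateRow x (Pi.single x 1) := by
    ext i j
    by_cases hi : i = x
    · subst hi
      by_cases hj : j = i
      · subst hj
        simp [cofFull]
      · have hj' : i ≠ j := fun h => hj h.symm
        simp [cofFull, hj, hj']
    · simp [cofFull, hi]
  rw [h1, h2, Matrix.det_updateRow_add, Matrix.det_updateRow_smul, Matrix.updateRow_eq_self]

lemma cofDet_congr {α : Type*} [Fintype α] [DecidableEq α]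
    (S : Finset α) (M N : Matrix α α ℂ) (a b : α)
    (h : ∀ x ∈ S, ∀ y ∈ S, x ≠ b → y ≠ a → M x y = N x y) :
    cofDet S M a b = cofDet S N a b := by
  unfold cofDet
  congr 1
  ext ⟨x, hx⟩ ⟨y, hy⟩
  by_cases h1 : x = b <;> by_cases h2 : y = a <;> simp [h1, h2]
  exact h x hx y hy h1 h2

lemma cofDet_expand {α : Type*} [Fintype α] [DecidableEq α]
    (M : Matrix α α ℂ) (a b : α) (d : α → ℂ) (V : Finset α) :
    ∀ S : Finset α, V ⊆ S → a ∉ V → b ∉ V →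
    cofDet S (M + Matrix.diagonal (fun x => if x ∈ V then d x else 0)) a b
      = ∑ W ∈ V.powerset, (∏ x ∈ W, d x) * cofDet (S \ W) M a b := by
  induction V using Finset.induction_on with
  | empty => intro S _ _ _; simp
  | insert x V hxV ih =>
    intro S hS ha hb
    rw [Finset.insert_subset_iff] at hS
    simp only [Finset.mem_insert, not_or] at ha hb
    have e : M + Matrix.diagonal (fun y => if y ∈ insert x V then d y else 0)
      = (M + Matrix.diagonal (fun y => if y ∈ V then d y else 0)) + Matrix.single x x (d x) := by
      ext i j
      simp only [Matrix.add_apply, Matrix.diagonal_apply, Matrix.single_apply, Finset.mem_insert]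
      by_cases hij : i = j
      · subst hij
        by_cases hi : i = x
        · subst hi; simp [hxV]
        · have hi' : x ≠ i := fun h => hi h.symm
          simp [hi, hi']
      · have : ¬ (x = i ∧ x = j) := by rintro ⟨rfl, rfl⟩; exact hij rfl
        simp [hij, this]
    rw [e, cofDet_step S _ a b x hS.1 (Ne.symm ha.1) (Ne.symm hb.1), ih S hS.2 ha.2 hb.2,
      ih (S.erase x) (fun y hy => Finset.mem_erase.2 ⟨by rintro rfl; exact hxV hy, hS.2 hy⟩)
        ha.2 hb.2, Finset.sum_powerset_insert hxV, Finset.mul_sum]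
    congr 1
    refine Finset.sum_congr rfl fun W hW => ?_
    have hxW : x ∉ W := fun h => hxV (Finset.mem_powerset.1 hW h)
    rw [Finset.prod_insert hxW, mul_assoc]
    congr 3
    ext y
    simp only [Finset.mem_sdiff, Finset.mem_erase, Finset.mem_insert]
    tauto

/-! ### Calculus part -/

/-- positive orthant -/
def orth (α : Type*) : Set (α → ℝ) := {l | ∀ x, 0 < l x}

lemma isOpen_orth (α : Type*) [Fintype α] : IsOpen (orth α) := by
  have : orth α = Set.univ.pi (fun _ => Set.Ioi 0) := by ext; simp [orth]
  rw [this]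
  exact isOpen_set_pi Set.finite_univ (fun _ _ => isOpen_Ioi)

section calculus
variable {α : Type*} [Fintype α] [DecidableEq α]

lemma pd_congr {f g : (α → ℝ) → ℂ} (x : α) (h : Set.EqOn f g (orth α)) :
    Set.EqOn (pd x f) (pd x g) (orth α) := by
  intro l hl
  unfold pd
  have : f =ᶠ[nhds l] g := Filter.eventuallyEq_of_mem ((isOpen_orth α).mem_nhds hl) h
  rw [this.fderiv_eq]

lemma pd_smooth {f : (α → ℝ) → ℂ} (x : α) (h : ContDiffOn ℝ ∞ f (orth α)) :
    ContDiffOn ℝ ∞ (pd x f) (orth α) := by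
  have := h.fderiv_of_isOpen (isOpen_orth α) (m := ∞) (by simp)
  exact this.clm_apply contDiffOn_const

lemma pd_comm {f : (α → ℝ) → ℂ} (x y : α) (h : ContDiffOn ℝ ∞ f (orth α)) :
    Set.EqOn (pd x (pd y f)) (pd y (pd x f)) (orth α) := by
  intro l hl
  have hc : ContDiffAt ℝ ∞ f l := h.contDiffAt ((isOpen_orth α).mem_nhds hl)
  have hs : IsSymmSndFDerivAt ℝ f l := hc.isSymmSndFDerivAt (by
    simp only [minSmoothness_of_isRCLikeNormedField]
    exact WithTop.coe_le_coe.2 (le_top : (2 : ℕ∞) ≤ ⊤))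
  have hd : DifferentiableAt ℝ (fderiv ℝ f) l :=
    ((h.fderiv_of_isOpen (isOpen_orth α) (m := ∞) (by simp)).contDiffAt
      ((isOpen_orth α).mem_nhds hl)).differentiableAt (by simp)
  have key : ∀ u v : α → ℝ, fderiv ℝ (fun l => fderiv ℝ f l u) l v
      = fderiv ℝ (fderiv ℝ f) l v u := by
    intro u v
    rw [fderiv_clm_apply hd (differentiableAt_const _)]
    simp
  unfold pd
  rw [key, key]
  exact hs _ _

lemma foldr_smooth {f : (α → ℝ) → ℂ} (L : List α) (h : ContDiffOn ℝ ∞ f (orth α)) :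
    ContDiffOn ℝ ∞ (L.foldr pd f) (orth α) := by
  induction L with
  | nil => exact h
  | cons x L ih => exact pd_smooth x ih

lemma foldr_perm {f : (α → ℝ) → ℂ} {L L' : List α} (p : L.Perm L')
    (h : ContDiffOn ℝ ∞ f (orth α)) :
    Set.EqOn (L.foldr pd f) (L'.foldr pd f) (orth α) := by
  induction p with
  | nil => exact fun _ _ => rfl
  | cons x _ ih => exact pd_congr x ih
  | swap x y L => exact pd_comm _ _ (foldr_smooth L h)
  | trans _ _ ih1 ih2 => exact ih1.trans ih2

lemma foldr_congr {f g : (α → ℝ) → ℂ} (L : List α) (h : Set.EqOn f g (orth α)) :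
    Set.EqOn (L.foldr pd f) (L.foldr pd g) (orth α) := by
  induction L with
  | nil => exact h
  | cons x L ih => exact pd_congr x ih

lemma mpart_insert {f : (α → ℝ) → ℂ} {x : α} {Q : Finset α} (hx : x ∉ Q)
    (h : ContDiffOn ℝ ∞ f (orth α)) :
    Set.EqOn (mpart (insert x Q) f) (pd x (mpart Q f)) (orth α) :=
  foldr_perm (Finset.toList_insert hx) h

/-- exponential prefactor -/
def Efac (c : α → ℝ) (l : α → ℝ) : ℂ := Complex.exp ((∑ x, l x * c x : ℝ) : ℂ)

lemma Efac_contDiff (c : α → ℝ) : ContDiff ℝ ∞ (Efac c) := by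
  unfold Efac
  refine ContDiff.cexp ?_
  refine Complex.ofRealCLM.contDiff.comp (f := fun l : α → ℝ => ∑ x, l x * c x) ?_
  exact ContDiff.sum fun x _ => (contDiff_apply ℝ ℝ x).mul contDiff_const

lemma pd_Efac (c : α → ℝ) (x : α) (l : α → ℝ) : pd x (Efac c) l = c x * Efac c l := by
  unfold pd
  have hE : DifferentiableAt ℝ (Efac c) l := (Efac_contDiff c).differentiable (by simp) l
  have hh : HasDerivAt (fun t : ℝ => Efac c (l + t • Pi.single x 1)) (fderiv ℝ (Efac c) l (Pi.single x 1)) 0 := by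
    have := hE.hasFDerivAt.hasLineDerivAt (Pi.single x 1)
    exact this
  refine hh.unique ?_
  have e : (fun t : ℝ => Efac c (l + t • Pi.single x 1))
      = fun t : ℝ => Complex.exp (((∑ y, l y * c y + t * c x : ℝ)) : ℂ) := by
    funext t
    unfold Efac
    congr 2
    simp [add_mul, Finset.sum_add_distrib, Pi.single_apply]
  rw [e]
  have h1 : HasDerivAt (fun t : ℝ => (∑ y, l y * c y + t * c x : ℝ)) (c x) 0 := by
    simpa using ((hasDerivAt_id (0:ℝ)).mul_const (c x)).const_add (∑ y, l y * c y)
  have h2 := h1.ofReal_comp.cexp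
  have e4 : (c x : ℂ) * Efac c l = Complex.exp ((∑ y, l y * c y + 0 * c x : ℝ) : ℂ) * (c x : ℂ) := by
    rw [Efac, zero_mul, add_zero, mul_comm]
  rw [e4]
  exact h2

lemma pd_mul {f g : (α → ℝ) → ℂ} (x : α) {l : α → ℝ} (hf : DifferentiableAt ℝ f l)
    (hg : DifferentiableAt ℝ g l) :
    pd x (fun l => f l * g l) l = pd x f l * g l + f l * pd x g l := by
  unfold pd
  rw [fderiv_fun_mul hf hg]
  simp only [_root_.add_apply, _root_.smul_apply, smul_eq_mul]
  ring

lemma mpart_Efac_mul {f : (α → ℝ) → ℂ} (h : ContDiffOn ℝ ∞ f (orth α)) (c : α → ℝ)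
    (Q : Finset α) :
    Set.EqOn (mpart Q (fun l => Efac c l * f l))
      (fun l => Efac c l * ∑ P ∈ Q.powerset, (∏ x ∈ Q \ P, (c x : ℂ)) * mpart P f l)
      (orth α) := by
  have hEf : ContDiffOn ℝ ∞ (fun l => Efac c l * f l) (orth α) :=
    (Efac_contDiff c).contDiffOn.mul h
  have hm : ∀ P : Finset α, ∀ l ∈ orth α, DifferentiableAt ℝ (mpart P f) l := fun P l hl =>
    ((foldr_smooth P.toList h).contDiffAt ((isOpen_orth α).mem_nhds hl)).differentiableAt (by simp)
  induction Q using Finset.induction_on with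
  | empty => intro l hl; simp [mpart]
  | insert x Q hx ih =>
    intro l hl
    show _ = Efac c l * ∑ P ∈ (insert x Q).powerset, (∏ x ∈ insert x Q \ P, (c x : ℂ)) * mpart P f l
    rw [mpart_insert hx hEf hl, pd_congr x ih hl,
      pd_mul x ((Efac_contDiff c).differentiable (by simp) l)
        (DifferentiableAt.fun_sum fun P _ => (hm P l hl).const_mul _), pd_Efac,
      Finset.sum_powerset_insert hx]
    have e1 : pd x (fun l => ∑ P ∈ Q.powerset, (∏ x ∈ Q \ P, (c x : ℂ)) * mpart P f l) l
        = ∑ P ∈ Q.powerset, (∏ x ∈ Q \ P, (c x : ℂ)) * pd x (mpart P f) l := by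
      unfold pd
      rw [fderiv_fun_sum fun P _ => (hm P l hl).const_mul _]
      simp only [_root_.sum_apply]
      refine Finset.sum_congr rfl fun P _ => ?_
      rw [fderiv_const_mul (hm P l hl)]
      simp
    rw [e1]
    have e2 : ∀ P ∈ Q.powerset, (∏ x ∈ insert x Q \ P, (c x : ℂ)) * mpart P f l
        = c x * ((∏ x ∈ Q \ P, (c x : ℂ)) * mpart P f l) := by
      intro P hP
      have hxP : x ∉ P := fun h => hx (Finset.mem_powerset.1 hP h)
      rw [Finset.insert_sdiff_of_notMem _ hxP, Finset.prod_insert (by simp [hx]), mul_assoc]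
    have e3 : ∀ P ∈ Q.powerset, (∏ x ∈ insert x Q \ insert x P, (c x : ℂ)) * mpart (insert x P) f l
        = (∏ x ∈ Q \ P, (c x : ℂ)) * pd x (mpart P f) l := by
      intro P hP
      have hxP : x ∉ P := fun h => hx (Finset.mem_powerset.1 hP h)
      rw [mpart_insert hxP h hl]
      congr 2
      ext y
      simp only [Finset.mem_sdiff, Finset.mem_insert]
      constructor
      · tauto
      · rintro ⟨h1, h2⟩
        refine ⟨Or.inr h1, ?_⟩
        rintro (rfl | h3)
        · exact hx h1
        · exact h2 h3
    rw [Finset.sum_congr rfl e2, Finset.sum_congr rfl e3, ← Finset.mul_sum]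
    ring

/-- parametric differentiation over a compact set -/
lemma param_hasFDerivAt {F : (α → ℝ) × (α → ℝ) → ℂ}
    (hF : ContDiffOn ℝ ∞ F (orth α ×ˢ Set.univ)) {K : Set (α → ℝ)} (hK : IsCompact K)
    {l : α → ℝ} (hl : l ∈ orth α) :
    HasFDerivAt (fun l => ∫ θ in K, F (l, θ))
      (∫ θ in K, (fderiv ℝ F (l, θ)).comp (ContinuousLinearMap.inl ℝ (α → ℝ) (α → ℝ))) l := by
  have hO : IsOpen (orth α ×ˢ (Set.univ : Set (α → ℝ))) := (isOpen_orth α).prod isOpen_univ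
  have hF' : ContinuousOn (fun p => (fderiv ℝ F p).comp
      (ContinuousLinearMap.inl ℝ (α → ℝ) (α → ℝ))) (orth α ×ˢ Set.univ) :=
    (hF.continuousOn_fderiv_of_isOpen hO (by simp)).clm_comp continuousOn_const
  obtain ⟨ε, hε, hball⟩ := Metric.nhds_basis_closedBall.mem_iff.1 ((isOpen_orth α).mem_nhds hl)
  have hsub : ∀ l' ∈ Metric.closedBall l ε, ∀ θ, (l', θ) ∈ orth α ×ˢ (Set.univ : Set (α → ℝ)) :=
    fun l' hl' θ => ⟨hball hl', trivial⟩
  have hcomp : IsCompact (Metric.closedBall l ε ×ˢ K) := (isCompact_closedBall l ε).prod hK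
  obtain ⟨C, hC⟩ := hcomp.exists_bound_of_continuousOn
    (hF'.mono (fun p hp => hsub p.1 hp.1 p.2))
  have hcont : ∀ l' ∈ orth α, ContinuousOn (fun θ => F (l', θ)) K := fun l' hl' =>
    hF.continuousOn.comp (by fun_prop) (fun θ _ => ⟨hl', trivial⟩)
  have hcont' : ContinuousOn (fun θ => (fderiv ℝ F (l, θ)).comp
      (ContinuousLinearMap.inl ℝ (α → ℝ) (α → ℝ))) K :=
    hF'.comp (f := fun θ => (l, θ)) (by fun_prop) (fun θ _ => ⟨hl, trivial⟩)
  refine hasFDerivAt_integral_of_dominated_of_fderiv_le (μ := volume.restrict K)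
    (F := fun l θ => F (l, θ))
    (F' := fun l θ => (fderiv ℝ F (l, θ)).comp (ContinuousLinearMap.inl ℝ (α → ℝ) (α → ℝ)))
    (bound := fun _ => C)
    (Metric.closedBall_mem_nhds l hε) ?_ ?_ ?_ ?_ ?_ ?_
  · filter_upwards [(isOpen_orth α).mem_nhds hl] with l' hl'
    exact (hcont l' hl').aestronglyMeasurable hK.measurableSet
  · exact (hcont l hl).integrableOn_compact hK
  · exact hcont'.aestronglyMeasurable hK.measurableSet
  · filter_upwards [ae_restrict_mem hK.measurableSet] with θ hθ l' hl'
    exact hC (l', θ) ⟨hl', hθ⟩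
  · exact (continuousOn_const (c := C)).integrableOn_compact hK
  · filter_upwards with θ l' hl'
    have h1 : HasFDerivAt F (fderiv ℝ F (l', θ)) (l', θ) :=
      ((hF.contDiffAt (hO.mem_nhds (hsub l' hl' θ))).differentiableAt (by simp)).hasFDerivAt
    have h2 : HasFDerivAt (fun l' : α → ℝ => (l', θ))
      (ContinuousLinearMap.inl ℝ (α → ℝ) (α → ℝ)) l' := hasFDerivAt_prodMk_left l' θ
    exact h1.comp l' h2

lemma param_contDiffOn {K : Set (α → ℝ)} (hK : IsCompact K) (n : ℕ) :
    ∀ F : (α → ℝ) × (α → ℝ) → ℂ, ContDiffOn ℝ ∞ F (orth α ×ˢ Set.univ) →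
    ContDiffOn ℝ n (fun l => ∫ θ in K, F (l, θ)) (orth α) := by
  have hO : IsOpen (orth α ×ˢ (Set.univ : Set (α → ℝ))) := (isOpen_orth α).prod isOpen_univ
  induction n with
  | zero =>
    intro F hF
    refine contDiffOn_zero.2 fun l hl => ?_
    exact (param_hasFDerivAt hF hK hl).continuousAt.continuousWithinAt
  | succ n ih =>
    intro F hF
    have e : ((n + 1 : ℕ) : WithTop ℕ∞) = (n : WithTop ℕ∞) + 1 := by push_cast; rfl
    rw [e, contDiffOn_succ_iff_fderiv_of_isOpen (isOpen_orth α)]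
    refine ⟨fun l hl => (param_hasFDerivAt hF hK hl).differentiableAt.differentiableWithinAt,
      by simp, ?_⟩
    have hFx : ∀ x : α, ContDiffOn ℝ ∞ (fun p => fderiv ℝ F p (Pi.single x 1, 0))
        (orth α ×ˢ Set.univ) := fun x =>
      (hF.fderiv_of_isOpen hO (m := ∞) (by simp)).clm_apply contDiffOn_const
    have hsum : ContDiffOn ℝ n (fun l => ∑ x : α,
        (ContinuousLinearMap.proj (R := ℝ) (φ := fun _ : α => ℝ) x).smulRight
          (∫ θ in K, fderiv ℝ F (l, θ) (Pi.single x 1, 0))) (orth α) := by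
      refine ContDiffOn.sum fun x _ => ?_
      exact ((ContinuousLinearMap.smulRightL ℝ (α → ℝ) ℂ
        (ContinuousLinearMap.proj (R := ℝ) (φ := fun _ : α => ℝ) x)).contDiff.comp_contDiffOn
          (ih _ (hFx x)))
    refine hsum.congr fun l hl => ?_
    rw [(param_hasFDerivAt hF hK hl).fderiv]
    have hcont' : ContinuousOn (fun θ => (fderiv ℝ F (l, θ)).comp
      (ContinuousLinearMap.inl ℝ (α → ℝ) (α → ℝ))) K :=
      ((hF.continuousOn_fderiv_of_isOpen hO (by simp)).clm_comp continuousOn_const).comp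
        (f := fun θ => (l, θ)) (by fun_prop) (fun θ _ => ⟨hl, trivial⟩)
    have hint := hcont'.integrableOn_compact (μ := volume) hK
    ext v
    rw [ContinuousLinearMap.integral_apply hint]
    have hFi : ∀ x : α, Integrable (fun θ => fderiv ℝ F (l, θ) (Pi.single x 1, 0))
        (volume.restrict K) := fun x =>
      (ContinuousOn.comp (f := fun θ => (l, θ)) (hFx x).continuousOn (by fun_prop)
        (fun θ _ => ⟨hl, trivial⟩)).integrableOn_compact hK
    have e2 : ∀ θ, (fderiv ℝ F (l, θ)).comp (ContinuousLinearMap.inl ℝ (α → ℝ) (α → ℝ)) v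
        = ∑ x, v x • fderiv ℝ F (l, θ) (Pi.single x 1, 0) := by
      intro θ
      conv_lhs => rw [pi_eq_sum_univ' v]
      rw [map_sum]
      refine Finset.sum_congr rfl fun x _ => ?_
      rw [map_smul]
      simp
    simp only [e2]
    rw [integral_finsetSum _ fun x _ => (by exact (hFi x).smul (v x))]
    simp [integral_const_mul]

lemma GM_smooth (M : Matrix α α ℝ) : ContDiffOn ℝ ∞ (GM M) (orth α) := by
  unfold GM
  refine contDiffOn_const.mul ?_
  have hK : IsCompact (Set.univ.pi (fun _ : α => Set.Icc (0:ℝ) (2 * Real.pi))) :=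
    isCompact_univ_pi fun _ => isCompact_Icc
  refine contDiffOn_infty.2 fun n => ?_
  refine param_contDiffOn hK n (fun p => Complex.exp (∑ x, ∑ y, (M x y : ℂ) *
    (Real.sqrt (p.1 x * p.1 y) : ℂ) * Complex.exp (Complex.I * ((p.2 x : ℂ) - (p.2 y : ℂ))))) ?_
  refine ContDiffOn.cexp (ContDiffOn.sum fun x _ => ContDiffOn.sum fun y _ => ?_)
  have hx : ∀ x : α, ContDiff ℝ ∞ (fun p : (α → ℝ) × (α → ℝ) => ((p.2 x : ℝ) : ℂ)) := fun x =>
    Complex.ofRealCLM.contDiff.comp (by fun_prop)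
  refine (contDiffOn_const.mul ?_).mul ?_
  · refine Complex.ofRealCLM.contDiff.comp_contDiffOn ?_
    refine ContDiffOn.sqrt (by fun_prop) fun p hp => ?_
    exact (mul_pos (hp.1 x) (hp.1 y)).ne'
  · exact (ContDiff.cexp (contDiff_const.mul ((hx x).sub (hx y)))).contDiffOn

lemma GM_factor (A B : Matrix α α ℝ) (hB : ∀ x y, B x y = if x = y then 0 else A x y) :
    Set.EqOn (GM A) (fun l => Efac (fun x => A x x) l * GM B l) (orth α) := by
  intro l hl
  simp only [GM, Efac]
  rw [mul_left_comm]
  congr 1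
  rw [← integral_const_mul]
  congr 1
  funext θ
  rw [← Complex.exp_add]
  congr 1
  push_cast
  rw [← Finset.sum_add_distrib]
  refine Finset.sum_congr rfl fun x _ => ?_
  rw [← Finset.add_sum_erase _ _ (Finset.mem_univ x),
    ← Finset.add_sum_erase _ (fun y => (B x y : ℂ) * _ * _) (Finset.mem_univ x)]
  have hs : Real.sqrt (l x * l x) = l x := Real.sqrt_mul_self (hl x).le
  rw [hs, hB x x]
  simp only [if_true, sub_self, mul_zero, Complex.exp_zero, mul_one, Complex.ofReal_zero, zero_mul,
    zero_add]
  rw [mul_comm]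
  congr 1
  refine Finset.sum_congr rfl fun y hy => ?_
  rw [hB x y, if_neg (Finset.ne_of_mem_erase hy).symm]

end calculus

/-- **Proposition 2.5(i).** With `B` the off-diagonal part of `A`,
`ρ_{ab}^{(R)}(l) = e^{Σ_x l_x A_{x,x}} (det_{ab}^{(R)}(−B + ∂_l) G_B)(l)`
for all `l ∈ (0,∞)^R`. -/
theorem rho_eq_offdiagonal_form
    {R : Type*} [Fintype R] [DecidableEq R]
    (A B : Matrix R R ℝ)
    (hB : ∀ x y, B x y = if x = y then 0 else A x y)
    (a b : R) (l : R → ℝ) (hl : ∀ x, 0 < l x) :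
    rho A a b l
      = Complex.exp ((∑ x, l x * A x x : ℝ) : ℂ) *
        ddet ((-B).map (fun r => (r : ℂ))) a b (GM B) l := by
  classical
  unfold rho ddet
  have h1 : ∀ Q : Finset R, mpart Q (GM A) l = Complex.exp ((∑ x, l x * A x x : ℝ) : ℂ) *
      ∑ P ∈ Q.powerset, (∏ x ∈ Q \ P, (A x x : ℂ)) * mpart P (GM B) l := by
    intro Q
    have e1 := foldr_congr Q.toList (GM_factor A B hB) (x := l) hl
    have e2 := mpart_Efac_mul (GM_smooth B) (fun x => A x x) Q (x := l) hl
    exact e1.trans e2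
  set T : Finset R := (Finset.univ : Finset R) \ {a, b} with hT
  have h2 : ∀ P ∈ T.powerset, cofDet (Finset.univ \ P) ((-B).map (fun r => (r : ℂ))) a b
      = ∑ W ∈ (T \ P).powerset, (∏ x ∈ W, (A x x : ℂ)) *
        cofDet ((Finset.univ \ P) \ W) ((-A).map (fun r => (r : ℂ))) a b := by
    intro P hP
    rw [← cofDet_expand _ a b (fun x => (A x x : ℂ)) (T \ P) (Finset.univ \ P)
      (Finset.sdiff_subset_sdiff (Finset.subset_univ _) subset_rfl) (by simp [hT]) (by simp [hT])]
    refine cofDet_congr _ _ _ a b fun x hx y hy hxb hya => ?_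
    by_cases hxy : x = y
    · subst hxy
      have : x ∈ T \ P := by
        simp only [hT, Finset.mem_sdiff, Finset.mem_univ, true_and, Finset.mem_insert,
          Finset.mem_singleton, not_or] at hx ⊢
        exact ⟨⟨hya, hxb⟩, hx⟩
      simp only [Matrix.add_apply, Matrix.map_apply, Matrix.neg_apply, Matrix.diagonal_apply_eq,
        if_pos this, hB x x, if_true]
      push_cast
      ring
    · simp [hB, hxy]
  have h3 : ∑ P ∈ T.powerset, cofDet (Finset.univ \ P) ((-B).map (fun r => (r : ℂ))) a b *
        mpart P (GM B) l
      = ∑ P ∈ T.powerset, (∑ W ∈ (T \ P).powerset, (∏ x ∈ W, (A x x : ℂ)) *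
        cofDet ((Finset.univ \ P) \ W) ((-A).map (fun r => (r : ℂ))) a b) * mpart P (GM B) l :=
    Finset.sum_congr rfl fun P hP => by rw [h2 P hP]
  rw [h3]
  simp only [h1]
  rw [Finset.mul_sum]
  simp only [Finset.mul_sum, Finset.sum_mul]
  rw [Finset.sum_sigma', Finset.sum_sigma']
  refine Finset.sum_bij' (fun p _ => ⟨p.2, p.1 \ p.2⟩) (fun p _ => ⟨p.1 ∪ p.2, p.1⟩) ?_ ?_ ?_ ?_ ?_
  · rintro ⟨Q, P⟩ h
    simp only [Finset.mem_sigma, Finset.mem_powerset] at h ⊢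
    exact ⟨h.2.trans h.1, Finset.sdiff_subset_sdiff h.1 subset_rfl⟩
  · rintro ⟨P, W⟩ h
    simp only [Finset.mem_sigma, Finset.mem_powerset] at h ⊢
    exact ⟨Finset.union_subset h.1 (h.2.trans Finset.sdiff_subset), Finset.subset_union_left⟩
  · rintro ⟨Q, P⟩ h
    simp only [Finset.mem_sigma, Finset.mem_powerset] at h
    simp [Finset.union_sdiff_of_subset h.2]
  · rintro ⟨P, W⟩ h
    simp only [Finset.mem_sigma, Finset.mem_powerset] at h
    have : Disjoint P W := (Finset.subset_sdiff.1 h.2).2.symm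
    simp [Finset.union_sdiff_cancel_left this]
  · rintro ⟨Q, P⟩ h
    simp only [Finset.mem_sigma, Finset.mem_powerset] at h
    have e : (Finset.univ \ P) \ (Q \ P) = Finset.univ \ Q := by
      rw [sdiff_sdiff_left, Finset.sup_eq_union, Finset.union_sdiff_of_subset h.2]
    simp only [e]
    ring

end
end
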